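/- arXiv:2104.02170 — 11 statements merged into one kernel-verified Lean document; each statement's English description precedes it below -/
import Mathlib

section
/- Let γ = (x,y) : I → ℝ² be a C³ unit-speed plane curve (x′² + y′² = 1) on an open interval I whose curvature κ = x′y″ − y′x″ is nowhere zero. Define the curve of osculating circles Γ = (a,b,r) : I → ℝ³ by (a,b) = (x,y) + (1/κ)(−y′, x′) and r = 1/κ. Then for every t ∈ I, Γ′(t) = −(κ′(t)/κ(t)²)·(−y′(t), x′(t), 1); in particular Γ is a null curve for the quadratic form −a² − b² + r², i.e., a′(t)² + b′(t)² = r′(t)² for all t ∈ I. -/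
/-- The velocity and the acceleration of a unit-speed plane curve are orthogonal. -/
theorem velocity_orthogonal_acceleration_of_unit_speed {I : Set ℝ} (hI : IsOpen I)
    {u v : ℝ → ℝ} {u' v' t : ℝ} (ht : t ∈ I) (hu : HasDerivAt u u' t) (hv : HasDerivAt v v' t)
    (hunit : ∀ s ∈ I, u s ^ 2 + v s ^ 2 = 1) :
    u t * u' + v t * v' = 0 := by
  have hconst : HasDerivAt (fun s => u s ^ 2 + v s ^ 2) 0 t :=
    (hasDerivAt_const t (1 : ℝ)).congr_of_eventuallyEq
      (Filter.eventually_of_mem (hI.mem_nhds ht) hunit)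
  have h := ((hu.fun_pow 2).fun_add (hv.fun_pow 2)).unique hconst
  norm_num at h
  linarith

/-- The Frenet equations in the plane: a vector orthogonal to the unit vector `(u, v)` is the
multiple of `(-v, u)` whose coefficient is its determinant with `(u, v)`. -/
theorem eq_det_mul_of_orthogonal_unit {u v p q : ℝ} (hunit : u ^ 2 + v ^ 2 = 1)
    (horth : u * p + v * q = 0) :
    p = -((u * q - v * p) * v) ∧ q = (u * q - v * p) * u := by
  constructor
  · linear_combination (-p) * hunit + u * horth
  · linear_combination (-q) * hunit + v * horth

/-- The curve of osculating circles `Γ = (a, b, r)` of a unit-speed plane curve with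
nowhere vanishing curvature `κ` has velocity `Γ' = -(κ'/κ²)·(-y', x', 1)`; in particular
it is a null curve for the Lorentzian form `-a² - b² + r²`. -/
theorem osculating_circles_curve_is_null
    (I : Set ℝ) (hI : IsOpen I)
    (x y x' y' x'' y'' κ' : ℝ → ℝ)
    (hx : ∀ t ∈ I, HasDerivAt x (x' t) t)
    (hy : ∀ t ∈ I, HasDerivAt y (y' t) t)
    (hx' : ∀ t ∈ I, HasDerivAt x' (x'' t) t)
    (hy' : ∀ t ∈ I, HasDerivAt y' (y'' t) t)
    (κ : ℝ → ℝ) (hκdef : ∀ t ∈ I, κ t = x' t * y'' t - y' t * x'' t)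
    (hκ' : ∀ t ∈ I, HasDerivAt κ (κ' t) t)
    (hunit : ∀ t ∈ I, x' t ^ 2 + y' t ^ 2 = 1)
    (hκne : ∀ t ∈ I, κ t ≠ 0)
    (a b r : ℝ → ℝ)
    (ha : ∀ t ∈ I, a t = x t - y' t / κ t)
    (hb : ∀ t ∈ I, b t = y t + x' t / κ t)
    (hr : ∀ t ∈ I, r t = 1 / κ t) :
    ∀ t ∈ I,
      HasDerivAt a (-(κ' t / κ t ^ 2) * (-(y' t))) t ∧
      HasDerivAt b (-(κ' t / κ t ^ 2) * x' t) t ∧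
      HasDerivAt r (-(κ' t / κ t ^ 2) * 1) t ∧
      (-(κ' t / κ t ^ 2) * (-(y' t))) ^ 2 + (-(κ' t / κ t ^ 2) * x' t) ^ 2
        = (-(κ' t / κ t ^ 2) * 1) ^ 2 := by
  intro t ht
  obtain ⟨hx'', hy''⟩ := eq_det_mul_of_orthogonal_unit (hunit t ht)
    (velocity_orthogonal_acceleration_of_unit_speed hI ht (hx' t ht) (hy' t ht) hunit)
  rw [← hκdef t ht] at hx'' hy''
  have hκt := hκne t ht
  have hnhds := hI.mem_nhds ht
  refine ⟨?_, ?_, ?_, ?_⟩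
  · refine (((hx t ht).fun_sub ((hy' t ht).fun_div (hκ' t ht) hκt)).congr_of_eventuallyEq
      (Filter.eventually_of_mem hnhds ha)).congr_deriv ?_
    rw [hy'']
    field_simp
    ring
  · refine (((hy t ht).fun_add ((hx' t ht).fun_div (hκ' t ht) hκt)).congr_of_eventuallyEq
      (Filter.eventually_of_mem hnhds hb)).congr_deriv ?_
    rw [hx'']
    field_simp
    ring
  · refine (((hasDerivAt_const t (1 : ℝ)).fun_div (hκ' t ht) hκt).congr_of_eventuallyEq
      (Filter.eventually_of_mem hnhds hr)).congr_deriv ?_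
    ring
  · linear_combination (κ' t / κ t ^ 2) ^ 2 * hunit t ht
end

section
/- Let Γ = (a, b, r) : [t₀, t₁] → ℝ³ be a continuously differentiable curve such that for every t ∈ [t₀, t₁] one has a′(t)² + b′(t)² = r′(t)² and Γ′(t) ≠ 0. If equality (r(t₁) − r(t₀))² = (a(t₁) − a(t₀))² + (b(t₁) − b(t₀))² holds, then for every t ∈ [t₀, t₁] the point Γ(t) lies on the straight line segment joining Γ(t₀) and Γ(t₁) (so the image of Γ is a null line segment). -/
/-- The displacement along a null curve with nondecreasing `r` is causal and future-directed. -/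
theorem null_curve_displacement_causal {t₀ t₁ : ℝ} (ht : t₀ ≤ t₁)
    {a b r a' b' r' : ℝ → ℝ}
    (ha : ∀ t ∈ Set.Icc t₀ t₁, HasDerivWithinAt a (a' t) (Set.Icc t₀ t₁) t)
    (hb : ∀ t ∈ Set.Icc t₀ t₁, HasDerivWithinAt b (b' t) (Set.Icc t₀ t₁) t)
    (hr : ∀ t ∈ Set.Icc t₀ t₁, HasDerivWithinAt r (r' t) (Set.Icc t₀ t₁) t)
    (hnull : ∀ t ∈ Set.Icc t₀ t₁, a' t ^ 2 + b' t ^ 2 = r' t ^ 2)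
    (hpos : ∀ t ∈ Set.Icc t₀ t₁, 0 ≤ r' t) :
    0 ≤ r t₁ - r t₀ ∧ (a t₁ - a t₀) ^ 2 + (b t₁ - b t₀) ^ 2 ≤ (r t₁ - r t₀) ^ 2 := by
  have key : ∀ c d ρ : ℝ, 0 ≤ ρ → c ^ 2 + d ^ 2 = ρ ^ 2 →
      c * (a t₁ - a t₀) + d * (b t₁ - b t₀) ≤ ρ * (r t₁ - r t₀) := by
    intro c d ρ hρ hcd
    have hderiv : ∀ t ∈ Set.Icc t₀ t₁, HasDerivWithinAt (fun x => ρ * r x - c * a x - d * b x)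
        (ρ * r' t - c * a' t - d * b' t) (Set.Icc t₀ t₁) t := fun t h =>
      (((hr t h).const_mul ρ).sub ((ha t h).const_mul c)).sub ((hb t h).const_mul d)
    have hmono : MonotoneOn (fun x => ρ * r x - c * a x - d * b x) (Set.Icc t₀ t₁) := by
      refine monotoneOn_of_hasDerivWithinAt_nonneg (convex_Icc _ _)
        (fun t h => (hderiv t h).continuousWithinAt)
        (fun t h => (hderiv t (interior_subset h)).mono interior_subset) fun t h => ?_
      have h := interior_subset h
      have : c * a' t + d * b' t ≤ ρ * r' t := by
        refine abs_le_of_sq_le_sq' ?_ (mul_nonneg hρ (hpos t h)) |>.2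
        rw [mul_pow, ← hcd, ← hnull t h]
        nlinarith [sq_nonneg (c * b' t - d * a' t)]
      linarith
    have := hmono (Set.left_mem_Icc.2 ht) (Set.right_mem_Icc.2 ht) ht
    simp only at this
    linarith
  have hr0 : 0 ≤ r t₁ - r t₀ := by
    linarith [key 1 0 1 zero_le_one (by norm_num), key (-1) 0 1 zero_le_one (by norm_num)]
  refine ⟨hr0, ?_⟩
  set A := a t₁ - a t₀
  set B := b t₁ - b t₀
  have hS : 0 ≤ A ^ 2 + B ^ 2 := by positivity
  have hk := key A B √(A ^ 2 + B ^ 2) (Real.sqrt_nonneg _) (Real.sq_sqrt hS).symm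
  nlinarith [Real.sq_sqrt hS, sq_nonneg (√(A ^ 2 + B ^ 2) - (r t₁ - r t₀))]

/-- Equality case of the reverse triangle inequality for causal vectors. -/
theorem exists_eq_mul_of_causal_add_null {x y z u v w : ℝ} (hz : 0 ≤ z) (hw : 0 ≤ w)
    (h₁ : x ^ 2 + y ^ 2 ≤ z ^ 2) (h₂ : u ^ 2 + v ^ 2 ≤ w ^ 2)
    (heq : (z + w) ^ 2 = (x + u) ^ 2 + (y + v) ^ 2) :
    ∃ s ∈ Set.Icc (0 : ℝ) 1, x = s * (x + u) ∧ y = s * (y + v) ∧ z = s * (z + w) := by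
  have cs : ∀ p q ρ : ℝ, 0 ≤ ρ → p ^ 2 + q ^ 2 ≤ ρ ^ 2 →
      (x + u) * p + (y + v) * q ≤ (z + w) * ρ := by
    intro p q ρ hρ h
    refine abs_le_of_sq_le_sq' ?_ (by positivity) |>.2
    have := mul_le_mul_of_nonneg_left h (sq_nonneg (z + w))
    rw [mul_pow]
    refine le_trans ?_ this
    rw [heq]
    nlinarith [sq_nonneg ((x + u) * q - (y + v) * p)]
  have e : (x + u) * x + (y + v) * y = (z + w) * z :=
    le_antisymm (cs x y z hz h₁) (by linarith [cs u v w hw h₂])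
  rcases (add_nonneg hz hw).eq_or_lt with h0 | hR
  · have hz0 : z = 0 := by linarith
    have hx : x = 0 := by nlinarith
    have hy : y = 0 := by nlinarith
    exact ⟨0, by simp, by simp [hx], by simp [hy], by simp [hz0]⟩
  · have hcross : (x + u) * y - (y + v) * x = 0 := by
      have h := mul_le_mul_of_nonneg_left h₁ (sq_nonneg (z + w))
      have e2 : ((x + u) * x + (y + v) * y) ^ 2 = (z + w) ^ 2 * z ^ 2 := by rw [e]; ring
      have e3 : ((x + u) * y - (y + v) * x) ^ 2 =
          (z + w) ^ 2 * (x ^ 2 + y ^ 2) - (z + w) ^ 2 * z ^ 2 := by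
        rw [← e2, heq]; ring
      exact pow_eq_zero_iff two_ne_zero |>.1 (le_antisymm (by linarith) (sq_nonneg _))
    refine ⟨z / (z + w), ⟨by positivity, (div_le_one hR).2 (by linarith)⟩, ?_, ?_, ?_⟩
    · have : (z + w) * ((z + w) * x) = (z + w) * (z * (x + u)) := by
        linear_combination x * heq + (x + u) * e - (y + v) * hcross
      have := mul_left_cancel₀ hR.ne' this
      field_simp
      linarith
    · have : (z + w) * ((z + w) * y) = (z + w) * (z * (y + v)) := by
        linear_combination y * heq + (y + v) * e + (x + u) * hcross
      have := mul_left_cancel₀ hR.ne' this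
      field_simp
      linarith
    · field_simp

/-- A null curve with nondecreasing `r` whose endpoints are null separated is contained in the
segment joining its endpoints. -/
theorem null_curve_mem_segment_of_nonneg {t₀ t₁ : ℝ}
    {a b r a' b' r' : ℝ → ℝ}
    (ha : ∀ t ∈ Set.Icc t₀ t₁, HasDerivWithinAt a (a' t) (Set.Icc t₀ t₁) t)
    (hb : ∀ t ∈ Set.Icc t₀ t₁, HasDerivWithinAt b (b' t) (Set.Icc t₀ t₁) t)
    (hr : ∀ t ∈ Set.Icc t₀ t₁, HasDerivWithinAt r (r' t) (Set.Icc t₀ t₁) t)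
    (hnull : ∀ t ∈ Set.Icc t₀ t₁, a' t ^ 2 + b' t ^ 2 = r' t ^ 2)
    (hpos : ∀ t ∈ Set.Icc t₀ t₁, 0 ≤ r' t)
    (heq : (r t₁ - r t₀) ^ 2 = (a t₁ - a t₀) ^ 2 + (b t₁ - b t₀) ^ 2) :
    ∀ t ∈ Set.Icc t₀ t₁, ∃ s ∈ Set.Icc (0 : ℝ) 1,
      a t = (1 - s) * a t₀ + s * a t₁ ∧
      b t = (1 - s) * b t₀ + s * b t₁ ∧
      r t = (1 - s) * r t₀ + s * r t₁ := by
  intro t h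
  have hl : Set.Icc t₀ t ⊆ Set.Icc t₀ t₁ := Set.Icc_subset_Icc_right h.2
  have hu : Set.Icc t t₁ ⊆ Set.Icc t₀ t₁ := Set.Icc_subset_Icc_left h.1
  obtain ⟨p₁, q₁⟩ := null_curve_displacement_causal h.1
    (fun x hx => (ha x (hl hx)).mono hl) (fun x hx => (hb x (hl hx)).mono hl)
    (fun x hx => (hr x (hl hx)).mono hl) (fun x hx => hnull x (hl hx))
    (fun x hx => hpos x (hl hx))
  obtain ⟨p₂, q₂⟩ := null_curve_displacement_causal h.2
    (fun x hx => (ha x (hu hx)).mono hu) (fun x hx => (hb x (hu hx)).mono hu)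
    (fun x hx => (hr x (hu hx)).mono hu) (fun x hx => hnull x (hu hx))
    (fun x hx => hpos x (hu hx))
  obtain ⟨s, hs, e₁, e₂, e₃⟩ := exists_eq_mul_of_causal_add_null p₁ p₂ q₁ q₂
    (by linear_combination heq)
  exact ⟨s, hs, by linear_combination e₁, by linear_combination e₂, by linear_combination e₃⟩

/-- A continuous function without zeros on an interval has constant sign there. -/
theorem nonneg_or_nonpos_of_continuousOn_Icc_ne_zero {t₀ t₁ : ℝ} {f : ℝ → ℝ}
    (hf : ContinuousOn f (Set.Icc t₀ t₁)) (hne : ∀ t ∈ Set.Icc t₀ t₁, f t ≠ 0) :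
    (∀ t ∈ Set.Icc t₀ t₁, 0 ≤ f t) ∨ ∀ t ∈ Set.Icc t₀ t₁, f t ≤ 0 := by
  by_contra! h
  obtain ⟨⟨x, hx, hfx⟩, y, hy, hfy⟩ := h
  obtain ⟨t, ht, h0⟩ := isPreconnected_Icc.intermediate_value hx hy hf ⟨hfx.le, hfy.le⟩
  exact hne t ht h0


/-- A regular null curve `Γ = (a, b, r) : [t₀, t₁] → ℝ³` (for the Lorentzian form
`-a² - b² + r²`) whose endpoints satisfy the equality
`(r(t₁) - r(t₀))² = (a(t₁) - a(t₀))² + (b(t₁) - b(t₀))²` is contained in the straight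
line segment joining its endpoints (a null line segment). -/
theorem null_curve_equality_is_segment
    (t₀ t₁ : ℝ) (ht : t₀ ≤ t₁)
    (a b r a' b' r' : ℝ → ℝ)
    (ha : ∀ t ∈ Set.Icc t₀ t₁, HasDerivWithinAt a (a' t) (Set.Icc t₀ t₁) t)
    (hb : ∀ t ∈ Set.Icc t₀ t₁, HasDerivWithinAt b (b' t) (Set.Icc t₀ t₁) t)
    (hr : ∀ t ∈ Set.Icc t₀ t₁, HasDerivWithinAt r (r' t) (Set.Icc t₀ t₁) t)
    (ha' : ContinuousOn a' (Set.Icc t₀ t₁))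
    (hb' : ContinuousOn b' (Set.Icc t₀ t₁))
    (hr' : ContinuousOn r' (Set.Icc t₀ t₁))
    (hnull : ∀ t ∈ Set.Icc t₀ t₁, a' t ^ 2 + b' t ^ 2 = r' t ^ 2)
    (hreg : ∀ t ∈ Set.Icc t₀ t₁, ¬(a' t = 0 ∧ b' t = 0 ∧ r' t = 0))
    (heq : (r t₁ - r t₀) ^ 2 = (a t₁ - a t₀) ^ 2 + (b t₁ - b t₀) ^ 2) :
    ∀ t ∈ Set.Icc t₀ t₁, ∃ s ∈ Set.Icc (0 : ℝ) 1,
      a t = (1 - s) * a t₀ + s * a t₁ ∧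
      b t = (1 - s) * b t₀ + s * b t₁ ∧
      r t = (1 - s) * r t₀ + s * r t₁ := by
  have hne : ∀ t ∈ Set.Icc t₀ t₁, r' t ≠ 0 := by
    intro t h h0
    have hn := hnull t h
    rw [h0] at hn
    exact hreg t h ⟨by nlinarith, by nlinarith, h0⟩
  rcases nonneg_or_nonpos_of_continuousOn_Icc_ne_zero hr' hne with hpos | hneg
  · exact null_curve_mem_segment_of_nonneg ha hb hr hnull hpos heq
  · intro t h
    obtain ⟨s, hs, e₁, e₂, e₃⟩ := null_curve_mem_segment_of_nonneg (r := fun x => -r x)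
      (r' := fun x => -r' x) ha hb (fun x hx => (hr x hx).neg)
      (fun x hx => by rw [neg_sq]; exact hnull x hx)
      (fun x hx => neg_nonneg.2 (hneg x hx)) (by linear_combination heq) t h
    exact ⟨s, hs, e₁, e₂, by linear_combination -e₃⟩
end

section
/- (Tait–Kneser) Let γ = (x,y) : I → ℝ² be a C³ unit-speed plane curve on an open interval I whose curvature κ = x′y″ − y′x″ satisfies κ(t) > 0 and κ′(t) > 0 for all t ∈ I (so γ is vertex-free with monotone non-vanishing curvature). For t ∈ I, let O(t) = γ(t) + (1/κ(t))(−y′(t), x′(t)) be the center and ρ(t) = 1/κ(t) the radius of the osculating circle at t. Then for any t₀ < t₁ in I, the closed disk of center O(t₁) and radius ρ(t₁) is contained in the open disk of center O(t₀) and radius ρ(t₀); in particular the osculating circles at distinct parameters are pairwise disjoint and nested. -/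
/-- A function with nonpositive derivative on an order-connected set that does not strictly
decrease between two points has vanishing derivative strictly between them. -/
lemma deriv_eq_zero_of_nonpos_of_le {I : Set ℝ} [hI : I.OrdConnected] {f f' : ℝ → ℝ}
    (hf : ∀ t ∈ I, HasDerivAt f (f' t) t) (hf' : ∀ t ∈ I, f' t ≤ 0)
    {a b : ℝ} (ha : a ∈ I) (hb : b ∈ I) (hle : f a ≤ f b) :
    ∀ t ∈ Set.Ioo a b, f' t = 0 := by
  intro t ht
  have hsub : Set.Icc a b ⊆ I := hI.out ha hb
  have hanti : AntitoneOn f (Set.Icc a b) := by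
    refine antitoneOn_of_hasDerivWithinAt_nonpos (f' := f') (convex_Icc a b)
      (fun s hs => (hf s (hsub hs)).continuousAt.continuousWithinAt)
      (fun s hs => (hf s (hsub (interior_subset hs))).hasDerivWithinAt)
      (fun s hs => hf' s (hsub (interior_subset hs)))
  have hab : a ≤ b := (ht.1.trans ht.2).le
  have hconst : f =ᶠ[nhds t] fun _ => f a := by
    filter_upwards [Ioo_mem_nhds ht.1 ht.2] with s hs
    have hs' := Set.Ioo_subset_Icc_self hs
    exact le_antisymm (hanti (Set.left_mem_Icc.2 hab) hs' hs'.1)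
      (hle.trans (hanti hs' (Set.right_mem_Icc.2 hab) hs'.2))
  exact (hf t (hsub (Set.Ioo_subset_Icc_self ht))).unique
    ((hasDerivAt_const t (f a)).congr_of_eventuallyEq hconst)

/-- Every plane vector has a unit vector along which its component is its length. -/
lemma exists_unit_inner_eq_sqrt (u v : ℝ) :
    ∃ a b : ℝ, a ^ 2 + b ^ 2 = 1 ∧ a * u + b * v = √(u ^ 2 + v ^ 2) := by
  by_cases h : u ^ 2 + v ^ 2 = 0
  · have hu : u = 0 := by nlinarith [sq_nonneg u, sq_nonneg v]
    have hv : v = 0 := by nlinarith [sq_nonneg u, sq_nonneg v]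
    exact ⟨1, 0, by simp [hu, hv]⟩
  · have hpos : 0 < u ^ 2 + v ^ 2 := lt_of_le_of_ne (by positivity) (Ne.symm h)
    have hs : √(u ^ 2 + v ^ 2) ≠ 0 := (Real.sqrt_pos.2 hpos).ne'
    have hsq := Real.sq_sqrt hpos.le
    refine ⟨u / √(u ^ 2 + v ^ 2), v / √(u ^ 2 + v ^ 2), ?_, ?_⟩
    · rw [div_pow, div_pow, hsq]
      field_simp
    · field_simp
      linarith

/-- The Frenet equations of a unit-speed plane curve. -/
lemma frenet_of_unit_speed {I : Set ℝ} (hI : IsOpen I) {x' y' x'' y'' : ℝ → ℝ}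
    (hx' : ∀ t ∈ I, HasDerivAt x' (x'' t) t) (hy' : ∀ t ∈ I, HasDerivAt y' (y'' t) t)
    (hunit : ∀ t ∈ I, x' t ^ 2 + y' t ^ 2 = 1) {t : ℝ} (ht : t ∈ I) :
    x'' t = -((x' t * y'' t - y' t * x'' t) * y' t) ∧
      y'' t = (x' t * y'' t - y' t * x'' t) * x' t := by
  have horth : x' t * x'' t + y' t * y'' t = 0 := by
    have h := ((hx' t ht).pow 2).add ((hy' t ht).pow 2)
    have hconst : (x' ^ 2 + y' ^ 2) =ᶠ[nhds t] fun _ => (1 : ℝ) := by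
      filter_upwards [hI.mem_nhds ht] with s hs
      exact hunit s hs
    have h0 := h.unique ((hasDerivAt_const t (1 : ℝ)).congr_of_eventuallyEq hconst)
    norm_num at h0
    linarith
  have hu := hunit t ht
  constructor
  · linear_combination -x'' t * hu + x' t * horth
  · linear_combination -y'' t * hu + y' t * horth


/-- **Tait–Kneser theorem.** Along a unit-speed plane curve with positive and strictly
increasing curvature `κ`, the osculating circles are pairwise nested: for `t₀ < t₁`, the
closed disk bounded by the osculating circle at `t₁` lies inside the open disk bounded by
the osculating circle at `t₀`. -/
theorem tait_kneser
    (I : Set ℝ) (hI : IsOpen I) (hIconn : I.OrdConnected)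
    (x y x' y' x'' y'' κ' : ℝ → ℝ)
    (hx : ∀ t ∈ I, HasDerivAt x (x' t) t)
    (hy : ∀ t ∈ I, HasDerivAt y (y' t) t)
    (hx' : ∀ t ∈ I, HasDerivAt x' (x'' t) t)
    (hy' : ∀ t ∈ I, HasDerivAt y' (y'' t) t)
    (hunit : ∀ t ∈ I, x' t ^ 2 + y' t ^ 2 = 1)
    (κ : ℝ → ℝ) (hκdef : ∀ t ∈ I, κ t = x' t * y'' t - y' t * x'' t)
    (hκ' : ∀ t ∈ I, HasDerivAt κ (κ' t) t)
    (hκ'cont : ContinuousOn κ' I)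
    (hκpos : ∀ t ∈ I, 0 < κ t)
    (hκ'pos : ∀ t ∈ I, 0 < κ' t)
    (O : ℝ → EuclideanSpace ℝ (Fin 2))
    (hO : ∀ t ∈ I, O t = (WithLp.equiv 2 (Fin 2 → ℝ)).symm
      ![x t + (1 / κ t) * (-(y' t)), y t + (1 / κ t) * x' t])
    (ρ : ℝ → ℝ) (hρ : ∀ t ∈ I, ρ t = 1 / κ t) :
    ∀ t₀ ∈ I, ∀ t₁ ∈ I, t₀ < t₁ →
      Metric.closedBall (O t₁) (ρ t₁) ⊆ Metric.ball (O t₀) (ρ t₀) := by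
  intro t₀ h₀ t₁ h₁ hlt
  have hsub : Set.Icc t₀ t₁ ⊆ I := hIconn.out h₀ h₁
  have hx'' : ∀ t ∈ I, x'' t = -(κ t * y' t) := fun t ht => by
    rw [hκdef t ht]; exact (frenet_of_unit_speed hI hx' hy' hunit ht).1
  have hy'' : ∀ t ∈ I, y'' t = κ t * x' t := fun t ht => by
    rw [hκdef t ht]; exact (frenet_of_unit_speed hI hx' hy' hunit ht).2
  set p : ℝ → ℝ := fun t => x t + (1 / κ t) * (-(y' t)) with hp
  set q : ℝ → ℝ := fun t => y t + (1 / κ t) * x' t with hq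
  have hinv : ∀ t ∈ I, HasDerivAt (fun s => 1 / κ s) (-(κ' t / κ t ^ 2)) t := fun t ht => by
    simp only [one_div, ← neg_div]
    exact (hκ' t ht).inv (hκpos t ht).ne'
  have hp' : ∀ t ∈ I, HasDerivAt p (κ' t / κ t ^ 2 * y' t) t := fun t ht => by
    have hne := (hκpos t ht).ne'
    refine ((hx t ht).add ((hinv t ht).mul (hy' t ht).neg)).congr_deriv ?_
    rw [hy'' t ht, Pi.neg_apply]
    field_simp
    ring
  have hq' : ∀ t ∈ I, HasDerivAt q (-(κ' t / κ t ^ 2 * x' t)) t := fun t ht => by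
    have hne := (hκpos t ht).ne'
    refine ((hy t ht).add ((hinv t ht).mul (hx' t ht))).congr_deriv ?_
    rw [hx'' t ht]
    field_simp
    ring
  obtain ⟨a, b, hab, hdist⟩ := exists_unit_inner_eq_sqrt (p t₁ - p t₀) (q t₁ - q t₀)
  have hf : ∀ t ∈ I, HasDerivAt (fun s => a * p s + b * q s + 1 / κ s)
      (κ' t / κ t ^ 2 * (a * y' t - b * x' t - 1)) t := fun t ht => by
    refine ((((hp' t ht).const_mul a).add ((hq' t ht).const_mul b)).add
      (hinv t ht)).congr_deriv ?_
    ring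
  have hspeed : ∀ t ∈ I, 0 < κ' t / κ t ^ 2 := fun t ht =>
    div_pos (hκ'pos t ht) (pow_pos (hκpos t ht) 2)
  have hkey : √((p t₁ - p t₀) ^ 2 + (q t₁ - q t₀) ^ 2) < 1 / κ t₀ - 1 / κ t₁ := by
    rw [← hdist]
    by_contra! hle
    have hzero := deriv_eq_zero_of_nonpos_of_le hf
      (fun t ht => mul_nonpos_of_nonneg_of_nonpos (hspeed t ht).le (by
        nlinarith [sq_nonneg (y' t - a), sq_nonneg (x' t + b), hunit t ht]))
      h₀ h₁ (by linarith)
    have hcoord : ∀ t ∈ Set.Ioo t₀ t₁, x' t = -b ∧ y' t = a := fun t ht => by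
      have htI := hsub (Set.Ioo_subset_Icc_self ht)
      have h := (mul_eq_zero.1 (hzero t ht)).resolve_left (hspeed t htI).ne'
      have hu := hunit t htI
      constructor <;> nlinarith [sq_nonneg (y' t - a), sq_nonneg (x' t + b)]
    obtain ⟨t, ht⟩ := Set.nonempty_Ioo.2 hlt
    have htI := hsub (Set.Ioo_subset_Icc_self ht)
    have hnhds := Ioo_mem_nhds ht.1 ht.2
    have hx0 : x'' t = 0 := (hx' t htI).unique
      ((hasDerivAt_const t (-b)).congr_of_eventuallyEq
        (Filter.mem_of_superset hnhds fun s hs => (hcoord s hs).1))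
    have hy0 : y'' t = 0 := (hy' t htI).unique
      ((hasDerivAt_const t a).congr_of_eventuallyEq
        (Filter.mem_of_superset hnhds fun s hs => (hcoord s hs).2))
    have hκt := hκpos t htI
    rw [hκdef t htI, hx0, hy0] at hκt
    simp at hκt
  refine Metric.closedBall_subset_ball' ?_
  have hd : dist (O t₁) (O t₀) = √((p t₁ - p t₀) ^ 2 + (q t₁ - q t₀) ^ 2) := by
    rw [hO t₁ h₁, hO t₀ h₀, EuclideanSpace.dist_eq]
    simp [Fin.sum_univ_two, Real.dist_eq, sq_abs, hp, hq]
  rw [hd, hρ t₀ h₀, hρ t₁ h₁]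
  linarith
end

section
/- Let γ = (x, y) : I → ℝ² be a C³ curve on an open interval I with x y′ − y x′ = 1, let p : I → ℝ be its centroaffine curvature (γ″ = −p γ), and let a = p y² + (y′)², b = −(p x y + x′ y′), c = p x² + (x′)² be the coefficients of the osculating central conics. Then a′ = p′ y², b′ = −p′ x y, c′ = p′ x², and consequently a′ c′ − (b′)² = 0; that is, the curve of osculating central conics is a null curve for the pseudo-Euclidean metric given by the determinant. -/
/-- The coefficients of the osculating central conics of a centroaffinely parametrized
curve satisfy `a′ = p′ y²`, `b′ = -p′ x y`, `c′ = p′ x²`, hence `a′ c′ - b′² = 0`: the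
curve of osculating central conics is null for the determinant metric. -/
theorem osculating_central_conics_curve_is_null
    (I : Set ℝ) (hI : IsOpen I)
    (x y x' y' p p' : ℝ → ℝ)
    (hx : ∀ t ∈ I, HasDerivAt x (x' t) t)
    (hy : ∀ t ∈ I, HasDerivAt y (y' t) t)
    (hx' : ∀ t ∈ I, HasDerivAt x' (-(p t * x t)) t)
    (hy' : ∀ t ∈ I, HasDerivAt y' (-(p t * y t)) t)
    (hp : ∀ t ∈ I, HasDerivAt p (p' t) t)
    (harea : ∀ t ∈ I, x t * y' t - y t * x' t = 1)
    (a b c : ℝ → ℝ)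
    (ha : ∀ t ∈ I, a t = p t * y t ^ 2 + y' t ^ 2)
    (hb : ∀ t ∈ I, b t = -(p t * x t * y t + x' t * y' t))
    (hc : ∀ t ∈ I, c t = p t * x t ^ 2 + x' t ^ 2) :
    ∀ t ∈ I,
      HasDerivAt a (p' t * y t ^ 2) t ∧
      HasDerivAt b (-(p' t * x t * y t)) t ∧
      HasDerivAt c (p' t * x t ^ 2) t ∧
      (p' t * y t ^ 2) * (p' t * x t ^ 2) - (-(p' t * x t * y t)) ^ 2 = 0 := by
  intro t ht
  have hnhds : I ∈ nhds t := hI.mem_nhds ht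
  refine ⟨?_, ?_, ?_, by ring⟩
  · have h := ((hp t ht).mul ((hy t ht).pow 2)).add ((hy' t ht).pow 2)
    refine (h.congr_of_eventuallyEq (Filter.eventually_of_mem hnhds ha)).congr_deriv ?_
    simp only [Pi.pow_apply]
    push_cast
    ring
  · have h := ((((hp t ht).mul (hx t ht)).mul (hy t ht)).add ((hx' t ht).mul (hy' t ht))).neg
    refine (h.congr_of_eventuallyEq (Filter.eventually_of_mem hnhds hb)).congr_deriv ?_
    simp only [Pi.mul_apply]
    ring
  · have h := ((hp t ht).mul ((hx t ht).pow 2)).add ((hx' t ht).pow 2)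
    refine (h.congr_of_eventuallyEq (Filter.eventually_of_mem hnhds hc)).congr_deriv ?_
    simp only [Pi.pow_apply]
    push_cast
    ring
end

section
/- (Centroaffine Tait–Kneser, disjointness) Let γ = (x, y) : I → ℝ² be a C³ curve on an open interval I with x y′ − y x′ = 1, whose centroaffine curvature p (defined by γ″ = −p γ) satisfies p(t) ≠ 0 and p′(t) ≠ 0 for all t ∈ I. For t ∈ I let Q_t(X,Y) = a(t)X² + 2b(t)XY + c(t)Y², where a = p y² + (y′)², b = −(p x y + x′ y′), c = p x² + (x′)². Then for any t₀ ≠ t₁ in I, the osculating central conics {v ∈ ℝ² : Q_{t₀}(v) = 1} and {v ∈ ℝ² : Q_{t₁}(v) = 1} are disjoint. -/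
/-- If `g' = q f²` with `q > 0` and `g` takes the same value at both ends of an interval, then
`f` vanishes inside the interval. -/
theorem eq_zero_of_hasDerivAt_mul_sq_of_pos {g f q : ℝ → ℝ} {s t : ℝ}
    (hg : ∀ u ∈ Set.Icc s t, HasDerivAt g (q u * f u ^ 2) u)
    (hq : ∀ u ∈ Set.Icc s t, 0 < q u) (hgst : g s = g t) :
    ∀ u ∈ Set.Ioo s t, f u = 0 := by
  intro u hu
  have hst : s ≤ t := (hu.1.trans hu.2).le
  have hmono : MonotoneOn g (Set.Icc s t) := by
    refine monotoneOn_of_hasDerivWithinAt_nonneg (f' := fun u ↦ q u * f u ^ 2)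
      (convex_Icc s t) (fun u hu ↦ (hg u hu).continuousAt.continuousWithinAt)
      (fun u hu ↦ (hg u (interior_subset hu)).hasDerivWithinAt) (fun u hu ↦ ?_)
    exact mul_nonneg (hq u (interior_subset hu)).le (sq_nonneg _)
  have hconst : g =ᶠ[nhds u] fun _ ↦ g s := by
    filter_upwards [Ioo_mem_nhds hu.1 hu.2] with v hv
    have hv' := Set.Ioo_subset_Icc_self hv
    exact le_antisymm ((hmono hv' (Set.right_mem_Icc.2 hst) hv'.2).trans_eq hgst.symm)
      (hmono (Set.left_mem_Icc.2 hst) hv' hv'.1)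
  have hu' := Set.Ioo_subset_Icc_self hu
  have hzero : q u * f u ^ 2 = 0 :=
    (hg u hu').unique ((hasDerivAt_const u (g s)).congr_of_eventuallyEq hconst)
  simpa [(hq u hu').ne'] using hzero

/-- If `f'' = -p f` with `p'` nonvanishing, and the energy `p f² + f'²` takes the same value at
both ends of a nondegenerate interval, then this value is zero. -/
theorem energy_eq_zero_of_eq {f f' p p' : ℝ → ℝ} {s t : ℝ} (hst : s < t)
    (hf : ∀ u ∈ Set.Icc s t, HasDerivAt f (f' u) u)
    (hf' : ∀ u ∈ Set.Icc s t, HasDerivAt f' (-(p u * f u)) u)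
    (hp : ∀ u ∈ Set.Icc s t, HasDerivAt p (p' u) u)
    (hp' : ∀ u ∈ Set.Icc s t, p' u ≠ 0)
    (heq : p s * f s ^ 2 + f' s ^ 2 = p t * f t ^ 2 + f' t ^ 2) :
    p s * f s ^ 2 + f' s ^ 2 = 0 := by
  have hg : ∀ u ∈ Set.Icc s t,
      HasDerivAt (fun u ↦ p u * f u ^ 2 + f' u ^ 2) (p' u * f u ^ 2) u := by
    intro u hu
    refine (((hp u hu).mul ((hf u hu).pow 2)).add ((hf' u hu).pow 2)).congr_deriv ?_
    simp only [Pi.pow_apply]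
    ring
  have hzero : ∀ u ∈ Set.Ioo s t, f u = 0 := by
    rcases hasDerivWithinAt_forall_lt_or_forall_gt_of_forall_ne (convex_Icc s t)
      (fun u hu ↦ (hp u hu).hasDerivWithinAt) hp' with hneg | hpos
    · exact eq_zero_of_hasDerivAt_mul_sq_of_pos (q := fun u ↦ -p' u)
        (fun u hu ↦ (hg u hu).neg.congr_deriv (by ring)) (fun u hu ↦ neg_pos.2 (hneg u hu))
        (congrArg Neg.neg heq)
    · exact eq_zero_of_hasDerivAt_mul_sq_of_pos hg hpos heq
  have hzero' : ∀ u ∈ Set.Ioo s t, f' u = 0 := fun u hu ↦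
    (hf u (Set.Ioo_subset_Icc_self hu)).unique <|
      (hasDerivAt_const u (0 : ℝ)).congr_of_eventuallyEq <| by
        filter_upwards [Ioo_mem_nhds hu.1 hu.2] with v hv using hzero v hv
  have hclosure : Set.EqOn (fun u ↦ p u * f u ^ 2 + f' u ^ 2) (fun _ ↦ 0) (Set.Icc s t) := by
    refine Set.EqOn.of_subset_closure (s := Set.Ioo s t) (fun u hu ↦ ?_)
      (fun u hu ↦ (hg u hu).continuousAt.continuousWithinAt) continuousOn_const
      Set.Ioo_subset_Icc_self (closure_Ioo hst.ne).ge
    simp [hzero u hu, hzero' u hu]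
  exact hclosure (Set.left_mem_Icc.2 hst.le)

/-- **Centroaffine Tait–Kneser (disjointness).** Along a centroaffinely parametrized
curve whose centroaffine curvature `p` is nonvanishing with nonvanishing derivative,
the osculating central conics at distinct parameters are disjoint. -/
theorem centroaffine_tait_kneser_disjoint
    (I : Set ℝ) (hI : IsOpen I) (hIconn : I.OrdConnected)
    (x y x' y' p p' : ℝ → ℝ)
    (hx : ∀ t ∈ I, HasDerivAt x (x' t) t)
    (hy : ∀ t ∈ I, HasDerivAt y (y' t) t)
    (hx' : ∀ t ∈ I, HasDerivAt x' (-(p t * x t)) t)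
    (hy' : ∀ t ∈ I, HasDerivAt y' (-(p t * y t)) t)
    (hp : ∀ t ∈ I, HasDerivAt p (p' t) t)
    (hp'cont : ContinuousOn p' I)
    (harea : ∀ t ∈ I, x t * y' t - y t * x' t = 1)
    (hpne : ∀ t ∈ I, p t ≠ 0)
    (hp'ne : ∀ t ∈ I, p' t ≠ 0)
    (a b c : ℝ → ℝ)
    (ha : ∀ t ∈ I, a t = p t * y t ^ 2 + y' t ^ 2)
    (hb : ∀ t ∈ I, b t = -(p t * x t * y t + x' t * y' t))
    (hc : ∀ t ∈ I, c t = p t * x t ^ 2 + x' t ^ 2)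
    (Q : ℝ → ℝ × ℝ → ℝ)
    (hQ : ∀ t ∈ I, ∀ v : ℝ × ℝ,
      Q t v = a t * v.1 ^ 2 + 2 * b t * v.1 * v.2 + c t * v.2 ^ 2) :
    ∀ t₀ ∈ I, ∀ t₁ ∈ I, t₀ ≠ t₁ →
      {v : ℝ × ℝ | Q t₀ v = 1} ∩ {v : ℝ × ℝ | Q t₁ v = 1} = ∅ := by
  have hQ' : ∀ t ∈ I, ∀ v : ℝ × ℝ,
      Q t v = p t * (y t * v.1 - x t * v.2) ^ 2 + (y' t * v.1 - x' t * v.2) ^ 2 := by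
    intro t ht v
    rw [hQ t ht, ha t ht, hb t ht, hc t ht]
    ring
  have hlt : ∀ s ∈ I, ∀ t ∈ I, s < t → ∀ v, Q s v = 1 → Q t v ≠ 1 := by
    intro s hs t ht hst v hvs hvt
    have hI' : Set.Icc s t ⊆ I := hIconn.out hs ht
    have hzero := energy_eq_zero_of_eq (f := fun u ↦ y u * v.1 - x u * v.2)
      (f' := fun u ↦ y' u * v.1 - x' u * v.2) hst
      (fun u hu ↦ ((hy u (hI' hu)).mul_const v.1).sub ((hx u (hI' hu)).mul_const v.2))
      (fun u hu ↦ (((hy' u (hI' hu)).mul_const v.1).sub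
        ((hx' u (hI' hu)).mul_const v.2)).congr_deriv (by ring))
      (fun u hu ↦ hp u (hI' hu)) (fun u hu ↦ hp'ne u (hI' hu))
      (by rw [← hQ' s hs, ← hQ' t ht, hvs, hvt])
    rw [← hQ' s hs, hvs] at hzero
    exact one_ne_zero hzero
  intro t₀ h₀ t₁ h₁ hne
  refine Set.eq_empty_iff_forall_notMem.2 fun v hv ↦ ?_
  rcases hne.lt_or_gt with h | h
  · exact hlt t₀ h₀ t₁ h₁ h v hv.1 hv.2
  · exact hlt t₁ h₁ t₀ h₀ h v hv.2 hv.1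
end

section
/- Let a, b, c : [t₀, t₁] → ℝ be continuously differentiable functions such that for all t ∈ [t₀, t₁]: b′(t)² = a′(t)·c′(t), a′(t) ≥ 0 and c′(t) ≥ 0 (nullity for the determinant metric, with monotone coefficients). Then (a(t₁) − a(t₀))·(c(t₁) − c(t₀)) − (b(t₁) − b(t₀))² ≥ 0. -/
/-- A binary quadratic form with nonnegative diagonal and vanishing discriminant is
nonnegative on vectors `(x, 1)`. -/
theorem quadratic_nonneg_of_sq_eq_mul {p q r : ℝ} (hp : 0 ≤ p) (hr : 0 ≤ r)
    (h : q ^ 2 = p * r) (x : ℝ) : 0 ≤ p * x ^ 2 + 2 * q * x + r := by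
  rcases hp.eq_or_lt with rfl | hp
  · have hq : q = 0 := by simpa using h
    simpa [hq] using hr
  · refine nonneg_of_mul_nonneg_right ?_ hp
    calc 0 ≤ (p * x + q) ^ 2 := sq_nonneg _
      _ = p * (p * x ^ 2 + 2 * q * x + r) := by linear_combination h


/-- A null curve `(a, b, c)` for the determinant metric `ac - b²`, with monotone
coefficients `a′ ≥ 0`, `c′ ≥ 0`, satisfies
`(a(t₁) - a(t₀))·(c(t₁) - c(t₀)) - (b(t₁) - b(t₀))² ≥ 0`. -/
theorem null_curve_det_metric_endpoints
    (t₀ t₁ : ℝ) (ht : t₀ ≤ t₁)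
    (a b c a' b' c' : ℝ → ℝ)
    (ha : ∀ t ∈ Set.Icc t₀ t₁, HasDerivWithinAt a (a' t) (Set.Icc t₀ t₁) t)
    (hb : ∀ t ∈ Set.Icc t₀ t₁, HasDerivWithinAt b (b' t) (Set.Icc t₀ t₁) t)
    (hc : ∀ t ∈ Set.Icc t₀ t₁, HasDerivWithinAt c (c' t) (Set.Icc t₀ t₁) t)
    (ha' : ContinuousOn a' (Set.Icc t₀ t₁))
    (hb' : ContinuousOn b' (Set.Icc t₀ t₁))
    (hc' : ContinuousOn c' (Set.Icc t₀ t₁))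
    (hnull : ∀ t ∈ Set.Icc t₀ t₁, b' t ^ 2 = a' t * c' t)
    (ha'pos : ∀ t ∈ Set.Icc t₀ t₁, 0 ≤ a' t)
    (hc'pos : ∀ t ∈ Set.Icc t₀ t₁, 0 ≤ c' t) :
    (a t₁ - a t₀) * (c t₁ - c t₀) - (b t₁ - b t₀) ^ 2 ≥ 0 := by
  have key (x : ℝ) :
      0 ≤ (a t₁ - a t₀) * (x * x) + 2 * (b t₁ - b t₀) * x + (c t₁ - c t₀) := by
    have hderiv : ∀ t ∈ Set.Icc t₀ t₁,
        HasDerivWithinAt (fun t => a t * x ^ 2 + 2 * b t * x + c t)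
          (a' t * x ^ 2 + 2 * b' t * x + c' t) (Set.Icc t₀ t₁) t := fun t h =>
      (((ha t h).mul_const _).add (((hb t h).const_mul 2).mul_const x)).add (hc t h)
    have hmono : MonotoneOn (fun t => a t * x ^ 2 + 2 * b t * x + c t) (Set.Icc t₀ t₁) :=
      monotoneOn_of_hasDerivWithinAt_nonneg (convex_Icc t₀ t₁)
        (fun t h => (hderiv t h).continuousWithinAt)
        (fun t h => (hderiv t (interior_subset h)).mono interior_subset)
        (fun t h => quadratic_nonneg_of_sq_eq_mul (ha'pos t (interior_subset h))
          (hc'pos t (interior_subset h)) (hnull t (interior_subset h)) x)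
    have hle := hmono (Set.left_mem_Icc.2 ht) (Set.right_mem_Icc.2 ht) ht
    dsimp only at hle
    linarith
  have hdisc := discrim_le_zero key
  unfold discrim at hdisc
  linarith
end

section
/- Let v₁ = (a₁, b₁, c₁) and v₂ = (a₂, b₂, c₂) be points of ℝ³ with (a₁ − a₂)² + (b₁ − b₂)² < (c₁ − c₂)². Then the corresponding Kepler conic sections S₁ and S₂ are disjoint, where S_i = {(x,y,z) ∈ ℝ³ : x² + y² = z² and a_i x + b_i y + c_i z = 1}; that is, no point of the cone x² + y² = z² lies on both planes a₁x + b₁y + c₁z = 1 and a₂x + b₂y + c₂z = 1. -/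
/-- Two Kepler conics whose parameter points `v₁ = (a₁, b₁, c₁)`, `v₂ = (a₂, b₂, c₂)`
satisfy `|v₁ - v₂|² > 0` for the Lorentzian form `-a² - b² + c²` are disjoint: no point
of the cone `x² + y² = z²` lies on both planes `aᵢ x + bᵢ y + cᵢ z = 1`. -/
theorem kepler_conics_disjoint_of_timelike
    (a₁ b₁ c₁ a₂ b₂ c₂ : ℝ)
    (h : (a₁ - a₂) ^ 2 + (b₁ - b₂) ^ 2 < (c₁ - c₂) ^ 2) :
    {v : ℝ × ℝ × ℝ | v.1 ^ 2 + v.2.1 ^ 2 = v.2.2 ^ 2 ∧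
        a₁ * v.1 + b₁ * v.2.1 + c₁ * v.2.2 = 1} ∩
      {v : ℝ × ℝ × ℝ | v.1 ^ 2 + v.2.1 ^ 2 = v.2.2 ^ 2 ∧
        a₂ * v.1 + b₂ * v.2.1 + c₂ * v.2.2 = 1} = ∅ := by
  refine Set.eq_empty_of_forall_notMem ?_
  rintro ⟨x, y, z⟩ ⟨⟨hcone, h₁⟩, ⟨-, h₂⟩⟩
  dsimp only at hcone h₁ h₂
  have hdiff : (c₁ - c₂) * z = -((a₁ - a₂) * x + (b₁ - b₂) * y) := by linarith
  have hle : (c₁ - c₂) ^ 2 * z ^ 2 ≤ ((a₁ - a₂) ^ 2 + (b₁ - b₂) ^ 2) * z ^ 2 := by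
    rw [← mul_pow, hdiff, ← hcone]
    linarith [sq_nonneg ((a₁ - a₂) * y - (b₁ - b₂) * x)]
  have hz : z = 0 := by
    by_contra hz
    exact absurd hle (not_le.mpr (mul_lt_mul_of_pos_right h (by positivity)))
  have hx : x = 0 := by
    subst hz
    exact pow_eq_zero_iff two_ne_zero |>.mp (by linarith [sq_nonneg x, sq_nonneg y])
  have hy : y = 0 := by
    subst hz hx
    exact pow_eq_zero_iff two_ne_zero |>.mp (by linarith)
  simp [hx, hy, hz] at h₁
end

section
/- Let a, b, c ∈ ℝ and let (x, y) ∈ ℝ² satisfy a x² + 2 b x y + c y² = 1 (a point of a central conic). Set u = x² − y² and v = 2 x y, the coordinates of the complex square (x + iy)². Then ((a − c)/2)·u + b·v + ((a + c)/2)·√(u² + v²) = 1; that is, the complex square map z ↦ z² takes the central (Hooke) conic with coefficients (a, b, c) into the Kepler conic with parameters ((a−c)/2, b, (a+c)/2). -/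
/-- The complex square map `z ↦ z²`, i.e. `(x, y) ↦ (x² - y², 2xy)`, takes the central
(Hooke) conic `a x² + 2b xy + c y² = 1` into the Kepler conic with parameters
`((a - c)/2, b, (a + c)/2)`, namely `A u + B v + C √(u² + v²) = 1`. -/
theorem square_map_hooke_to_kepler
    (a b c x y : ℝ) (h : a * x ^ 2 + 2 * b * x * y + c * y ^ 2 = 1)
    (u v : ℝ) (hu : u = x ^ 2 - y ^ 2) (hv : v = 2 * x * y) :
    (a - c) / 2 * u + b * v + (a + c) / 2 * Real.sqrt (u ^ 2 + v ^ 2) = 1 := by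
  have hsqrt : Real.sqrt (u ^ 2 + v ^ 2) = x ^ 2 + y ^ 2 := by
    rw [hu, hv, show (x ^ 2 - y ^ 2) ^ 2 + (2 * x * y) ^ 2 = (x ^ 2 + y ^ 2) ^ 2 by ring]
    exact Real.sqrt_sq (by positivity)
  rw [hsqrt, hu, hv]
  linear_combination h
end

section
/- (Tait–Kneser for osculating parabolas) Let I ⊆ ℝ be an open interval and f : I → ℝ three times differentiable with f‴(x) > 0 for all x ∈ I. For x₀ ∈ I let T_{x₀}(x) = f(x₀) + f′(x₀)(x − x₀) + ½ f″(x₀)(x − x₀)² be the osculating parabola (second Taylor polynomial) of f at x₀. Then for any x₀ < x₁ in I and every x ∈ ℝ, T_{x₀}(x) < T_{x₁}(x); in particular the graphs of the osculating parabolas at distinct points of I are pairwise disjoint. -/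
/-- The value at a fixed `x` of the osculating parabola at `t` has `t`-derivative
`f‴(t) / 2 * (x - t) ^ 2`. -/
theorem hasDerivAt_osculatingParabola {f f' f'' : ℝ → ℝ} {f₃ t : ℝ} (x : ℝ)
    (hf : HasDerivAt f (f' t) t) (hf' : HasDerivAt f' (f'' t) t) (hf'' : HasDerivAt f'' f₃ t) :
    HasDerivAt (fun s => f s + f' s * (x - s) + f'' s / 2 * (x - s) ^ 2)
      (f₃ / 2 * (x - t) ^ 2) t := by
  have hx : HasDerivAt (fun s => x - s) (-1) t := (hasDerivAt_id t).const_sub x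
  refine ((hf.add (hf'.mul hx)).add ((hf''.div_const 2).mul (hx.pow 2))).congr_deriv ?_
  simp only [Pi.pow_apply, Nat.cast_ofNat, Nat.add_one_sub_one, pow_one]
  ring

/-- **Tait–Kneser for osculating parabolas.** If `f‴ > 0` on an open interval `I`, then
for `x₀ < x₁` in `I` the osculating parabola (second Taylor polynomial) of `f` at `x₀`
lies strictly below the one at `x₁`, everywhere on `ℝ`; in particular their graphs are
disjoint. -/
theorem tait_kneser_parabolas
    (I : Set ℝ) (hI : IsOpen I) (hIconn : I.OrdConnected)
    (f f' f'' f''' : ℝ → ℝ)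
    (hf : ∀ x ∈ I, HasDerivAt f (f' x) x)
    (hf' : ∀ x ∈ I, HasDerivAt f' (f'' x) x)
    (hf'' : ∀ x ∈ I, HasDerivAt f'' (f''' x) x)
    (hpos : ∀ x ∈ I, 0 < f''' x) :
    ∀ x₀ ∈ I, ∀ x₁ ∈ I, x₀ < x₁ → ∀ x : ℝ,
      f x₀ + f' x₀ * (x - x₀) + f'' x₀ / 2 * (x - x₀) ^ 2 <
        f x₁ + f' x₁ * (x - x₁) + f'' x₁ / 2 * (x - x₁) ^ 2 := by
  intro x₀ h₀ x₁ h₁ h₀₁ x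
  set T : ℝ → ℝ := fun s => f s + f' s * (x - s) + f'' s / 2 * (x - s) ^ 2
  have hT : ∀ t ∈ I, HasDerivAt T (f''' t / 2 * (x - t) ^ 2) t := fun t ht =>
    hasDerivAt_osculatingParabola x (hf t ht) (hf' t ht) (hf'' t ht)
  have key : ∀ a ∈ I, ∀ b ∈ I, a < b → x ∉ Set.Ioo a b → T a < T b := by
    intro a ha b hb hab hx
    have hsub : Set.Icc a b ⊆ I := hIconn.out ha hb
    refine strictMonoOn_of_deriv_pos (convex_Icc a b)
      (fun t ht => (hT t (hsub ht)).continuousAt.continuousWithinAt) (fun t ht => ?_)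
      (Set.left_mem_Icc.2 hab.le) (Set.right_mem_Icc.2 hab.le) hab
    rw [interior_Icc] at ht
    have htI : t ∈ I := hsub (Set.Ioo_subset_Icc_self ht)
    rw [(hT t htI).deriv]
    have hne : x - t ≠ 0 := sub_ne_zero.2 fun h => hx (h ▸ ht)
    have := hpos t htI
    positivity
  change T x₀ < T x₁
  by_cases hx : x ∈ Set.Ioo x₀ x₁
  · have hxI : x ∈ I := hIconn.out h₀ h₁ (Set.Ioo_subset_Icc_self hx)
    exact (key x₀ h₀ x hxI hx.1 fun h => lt_irrefl x h.2).trans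
      (key x hxI x₁ h₁ hx.2 fun h => lt_irrefl x h.1)
  · exact key x₀ h₀ x₁ h₁ h₀₁ hx
end

section
/- Let a, b, c : [t₀, t₁] → ℝ be continuously differentiable functions such that for all t ∈ [t₀, t₁]: b′(t)² = 4·a′(t)·c′(t), a′(t) ≥ 0 and c′(t) ≥ 0 (a null curve for the metric db² − 4·da·dc with monotone coefficients). Then 4·(a(t₁) − a(t₀))·(c(t₁) − c(t₀)) − (b(t₁) − b(t₀))² ≥ 0. -/
/-- A real quadratic with nonnegative outer coefficients and zero discriminant is nonnegative. -/
theorem quadratic_nonneg_of_sq_eq {p q r : ℝ} (h : q ^ 2 = 4 * (p * r)) (hp : 0 ≤ p)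
    (hr : 0 ≤ r) (x : ℝ) : 0 ≤ p * (x * x) + q * x + r := by
  rcases hp.eq_or_lt with rfl | hp
  · have hq : q = 0 := by simpa using h
    simpa [hq] using hr
  · have key : 4 * p * (p * (x * x) + q * x + r) = (2 * p * x + q) ^ 2 := by
      linear_combination -h
    exact nonneg_of_mul_nonneg_right (key ▸ sq_nonneg _) (by positivity : 0 < 4 * p)


/-- A null curve `(a, b, c)` for the metric `db² - 4·da·dc` with monotone coefficients
`a′ ≥ 0`, `c′ ≥ 0` satisfies `4(a(t₁) - a(t₀))(c(t₁) - c(t₀)) - (b(t₁) - b(t₀))² ≥ 0`. -/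
theorem null_curve_parabola_metric_endpoints
    (t₀ t₁ : ℝ) (ht : t₀ ≤ t₁)
    (a b c a' b' c' : ℝ → ℝ)
    (ha : ∀ t ∈ Set.Icc t₀ t₁, HasDerivWithinAt a (a' t) (Set.Icc t₀ t₁) t)
    (hb : ∀ t ∈ Set.Icc t₀ t₁, HasDerivWithinAt b (b' t) (Set.Icc t₀ t₁) t)
    (hc : ∀ t ∈ Set.Icc t₀ t₁, HasDerivWithinAt c (c' t) (Set.Icc t₀ t₁) t)
    (ha' : ContinuousOn a' (Set.Icc t₀ t₁))
    (hb' : ContinuousOn b' (Set.Icc t₀ t₁))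
    (hc' : ContinuousOn c' (Set.Icc t₀ t₁))
    (hnull : ∀ t ∈ Set.Icc t₀ t₁, b' t ^ 2 = 4 * (a' t * c' t))
    (ha'pos : ∀ t ∈ Set.Icc t₀ t₁, 0 ≤ a' t)
    (hc'pos : ∀ t ∈ Set.Icc t₀ t₁, 0 ≤ c' t) :
    4 * ((a t₁ - a t₀) * (c t₁ - c t₀)) - (b t₁ - b t₀) ^ 2 ≥ 0 := by
  have hquad (x : ℝ) :
      0 ≤ (a t₁ - a t₀) * (x * x) + (b t₁ - b t₀) * x + (c t₁ - c t₀) := by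
    have hderiv (t : ℝ) (h : t ∈ Set.Icc t₀ t₁) :
        HasDerivWithinAt (fun s ↦ a s * (x * x) + b s * x + c s)
          (a' t * (x * x) + b' t * x + c' t) (Set.Icc t₀ t₁) t :=
      (((ha t h).mul_const _).add ((hb t h).mul_const _)).add (hc t h)
    have hmono : MonotoneOn (fun s ↦ a s * (x * x) + b s * x + c s) (Set.Icc t₀ t₁) :=
      monotoneOn_of_hasDerivWithinAt_nonneg (convex_Icc t₀ t₁)
        (fun t h ↦ (hderiv t h).continuousWithinAt)
        (fun t h ↦ (hderiv t (interior_subset h)).mono interior_subset)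
        (fun t h ↦ quadratic_nonneg_of_sq_eq (hnull t (interior_subset h))
          (ha'pos t (interior_subset h)) (hc'pos t (interior_subset h)) x)
    have hle := hmono (Set.left_mem_Icc.2 ht) (Set.right_mem_Icc.2 ht) ht
    dsimp only at hle
    linarith
  have hdiscrim := discrim_le_zero hquad
  rw [discrim] at hdiscrim
  linarith
end

section
/- (Centroaffine Tait–Kneser, ellipse nesting) Let γ = (x, y) : I → ℝ² be a C³ curve on an open interval I with x y′ − y x′ = 1, whose centroaffine curvature p (defined by γ″ = −p γ) satisfies p(t) > 0 and p′(t) > 0 for all t ∈ I. For t ∈ I let Q_t(X,Y) = a(t)X² + 2b(t)XY + c(t)Y², where a = p y² + (y′)², b = −(p x y + x′ y′), c = p x² + (x′)², so each osculating central conic {Q_t = 1} is an ellipse. Then for any t₀ < t₁ in I the closed elliptic disks are nested: {v ∈ ℝ² : Q_{t₁}(v) ≤ 1} ⊆ {v ∈ ℝ² : Q_{t₀}(v) ≤ 1}. -/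
/-- If `u'' = -p u`, then the energy `p u² + u'²` has derivative `p' u²`. -/
theorem hasDerivAt_energy {u u' p : ℝ → ℝ} {p' t : ℝ} (hu : HasDerivAt u (u' t) t)
    (hu' : HasDerivAt u' (-(p t * u t)) t) (hp : HasDerivAt p p' t) :
    HasDerivAt (fun s => p s * u s ^ 2 + u' s ^ 2) (p' * u t ^ 2) t := by
  refine ((hp.fun_mul (hu.fun_pow 2)).fun_add (hu'.fun_pow 2)).congr_deriv ?_
  push_cast
  ring

/-- If `u'' = -p u` with `p' ≥ 0` on an interval, then the energy `p u² + u'²` is monotone. -/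
theorem monotoneOn_energy {I : Set ℝ} (hI : I.OrdConnected) {u u' p p' : ℝ → ℝ}
    (hu : ∀ t ∈ I, HasDerivAt u (u' t) t) (hu' : ∀ t ∈ I, HasDerivAt u' (-(p t * u t)) t)
    (hp : ∀ t ∈ I, HasDerivAt p (p' t) t) (hp' : ∀ t ∈ I, 0 ≤ p' t) :
    MonotoneOn (fun t => p t * u t ^ 2 + u' t ^ 2) I := by
  have h : ∀ t ∈ I, HasDerivAt (fun s => p s * u s ^ 2 + u' s ^ 2) (p' t * u t ^ 2) t :=
    fun t ht => hasDerivAt_energy (hu t ht) (hu' t ht) (hp t ht)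
  refine monotoneOn_of_hasDerivWithinAt_nonneg hI.convex
    (fun t ht => (h t ht).continuousAt.continuousWithinAt)
    (fun t ht => (h t (interior_subset ht)).hasDerivWithinAt)
    fun t ht => mul_nonneg (hp' t (interior_subset ht)) (sq_nonneg _)

/-- **Centroaffine Tait–Kneser (ellipse nesting).** Along a centroaffinely parametrized
curve whose centroaffine curvature `p` is positive and strictly increasing, the closed
elliptic disks bounded by the osculating central conics are nested: the disk at `t₁`
is contained in the disk at `t₀` whenever `t₀ < t₁`. -/
theorem centroaffine_tait_kneser_nested
    (I : Set ℝ) (hI : IsOpen I) (hIconn : I.OrdConnected)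
    (x y x' y' p p' : ℝ → ℝ)
    (hx : ∀ t ∈ I, HasDerivAt x (x' t) t)
    (hy : ∀ t ∈ I, HasDerivAt y (y' t) t)
    (hx' : ∀ t ∈ I, HasDerivAt x' (-(p t * x t)) t)
    (hy' : ∀ t ∈ I, HasDerivAt y' (-(p t * y t)) t)
    (hp : ∀ t ∈ I, HasDerivAt p (p' t) t)
    (hp'cont : ContinuousOn p' I)
    (harea : ∀ t ∈ I, x t * y' t - y t * x' t = 1)
    (hppos : ∀ t ∈ I, 0 < p t)
    (hp'pos : ∀ t ∈ I, 0 < p' t)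
    (a b c : ℝ → ℝ)
    (ha : ∀ t ∈ I, a t = p t * y t ^ 2 + y' t ^ 2)
    (hb : ∀ t ∈ I, b t = -(p t * x t * y t + x' t * y' t))
    (hc : ∀ t ∈ I, c t = p t * x t ^ 2 + x' t ^ 2)
    (Q : ℝ → ℝ × ℝ → ℝ)
    (hQ : ∀ t ∈ I, ∀ v : ℝ × ℝ,
      Q t v = a t * v.1 ^ 2 + 2 * b t * v.1 * v.2 + c t * v.2 ^ 2) :
    ∀ t₀ ∈ I, ∀ t₁ ∈ I, t₀ < t₁ →
      {v : ℝ × ℝ | Q t₁ v ≤ 1} ⊆ {v : ℝ × ℝ | Q t₀ v ≤ 1} := by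
  intro t₀ ht₀ t₁ ht₁ hlt v hv
  have hQu : ∀ t ∈ I, Q t v =
      p t * (x t * v.2 - y t * v.1) ^ 2 + (x' t * v.2 - y' t * v.1) ^ 2 := by
    intro t ht
    rw [hQ t ht, ha t ht, hb t ht, hc t ht]
    ring
  have hmono := monotoneOn_energy hIconn
    (u := fun t => x t * v.2 - y t * v.1) (u' := fun t => x' t * v.2 - y' t * v.1)
    (fun t ht => ((hx t ht).mul_const v.2).fun_sub ((hy t ht).mul_const v.1))
    (fun t ht => (((hx' t ht).mul_const v.2).fun_sub ((hy' t ht).mul_const v.1)).congr_deriv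
      (by ring))
    hp (fun t ht => (hp'pos t ht).le) ht₀ ht₁ hlt.le
  have hle : Q t₀ v ≤ Q t₁ v := by
    rw [hQu t₀ ht₀, hQu t₁ ht₁]
    exact hmono
  exact hle.trans hv
end
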